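/- arXiv:math/9806131 — 2 statements merged into one kernel-verified Lean document; each statement's English description precedes it below -/
import Mathlib

section
/- If α ≥ 0 satisfies the branching condition with α < 1, and α₀ ≥ 0 satisfies the α₀ condition, then Σ_{γ∈G₀} e^{−β|γ|} Σ_{n≥0} Σ_{θ∈G} |θ|·m^n(γ,θ) ≤ α₀/(1−α). (This is the majorant proving the space-width bound E[SW(A^{x,0})] ≤ α₀(β)/(1−α(β)) of Theorem 5.3(iii).) -/
open scoped ENNReal Classical

/-- The branching kernel `m(γ,θ) = e^{-β|θ|} 1{θ ≁ γ}` of the multitype branching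
process dominating the clan of ancestors.  Here `inc θ γ` means "θ is incompatible
with γ" and `w` is the weight (number of plaquettes) function. -/
noncomputable def contourKernel {G : Type*} (w : G → ℝ) (inc : G → G → Prop) (β : ℝ)
    (γ θ : G) : ℝ≥0∞ :=
  if inc θ γ then ENNReal.ofReal (Real.exp (-β * w θ)) else 0

/-- Iterates of the kernel: `m⁰(γ,θ) = 1{θ = γ}` and
`m^{n+1}(γ,θ) = Σ_{γ'} m(γ,γ')·m^n(γ',θ)`. -/
noncomputable def contourKernelIter {G : Type*} (w : G → ℝ) (inc : G → G → Prop) (β : ℝ) :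
    ℕ → G → G → ℝ≥0∞
  | 0, γ, θ => if θ = γ then 1 else 0
  | n + 1, γ, θ => ∑' γ' : G, contourKernel w inc β γ γ' * contourKernelIter w inc β n γ' θ

/-- If each type `γ` has offspring of total weight at most `a * w γ`, the total weight of the `n`-th generation
started from `γ` is at most `a ^ n * w γ`. -/
theorem tsum_weight_mul_contourKernelIter_le {G : Type*} (w : G → ℝ) (inc : G → G → Prop) (β : ℝ)
    (a : ℝ≥0∞)
    (hbranch : ∀ γ : G,
      ∑' θ : G, ENNReal.ofReal (w θ) * contourKernel w inc β γ θ ≤ a * ENNReal.ofReal (w γ))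
    (n : ℕ) (γ : G) :
    ∑' θ : G, ENNReal.ofReal (w θ) * contourKernelIter w inc β n γ θ ≤
      a ^ n * ENNReal.ofReal (w γ) := by
  induction n generalizing γ with
  | zero => simp [contourKernelIter]
  | succ n ih =>
    calc ∑' θ : G, ENNReal.ofReal (w θ) * contourKernelIter w inc β (n + 1) γ θ
        = ∑' γ' : G, contourKernel w inc β γ γ' *
            ∑' θ : G, ENNReal.ofReal (w θ) * contourKernelIter w inc β n γ' θ := by
          simp only [contourKernelIter, ← ENNReal.tsum_mul_left]
          rw [ENNReal.tsum_comm]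
          simp only [mul_left_comm]
      _ ≤ ∑' γ' : G, contourKernel w inc β γ γ' * (a ^ n * ENNReal.ofReal (w γ')) := by
          gcongr with γ'
          exact ih γ'
      _ = a ^ n * ∑' γ' : G, ENNReal.ofReal (w γ') * contourKernel w inc β γ γ' := by
          rw [← ENNReal.tsum_mul_left]
          congr 1 with γ'
          ring
      _ ≤ a ^ n * (a * ENNReal.ofReal (w γ)) := by
          gcongr
          exact hbranch γ
      _ = a ^ (n + 1) * ENNReal.ofReal (w γ) := by ring

/-- Majorant proving the space-width bound `E[SW(A^{x,0})] ≤ α₀(β)/(1-α(β))` of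
Theorem 5.3(iii): `Σ_{γ ∋ x} e^{-β|γ|} Σ_{n≥0} Σ_θ |θ| m^n(γ,θ) ≤ α₀/(1-α)`,
where `G₀` is the set of contours containing the fixed site `x`. -/
theorem spaceWidth_majorant {G : Type*} [Countable G] (w : G → ℝ) (hw : ∀ γ : G, 1 ≤ w γ)
    (inc : G → G → Prop) (β : ℝ) (α : ℝ) (hα : 0 ≤ α) (hα1 : α < 1)
    (hbranch : ∀ γ : G,
      ∑' θ : G, ENNReal.ofReal (w θ) * contourKernel w inc β γ θ ≤
        ENNReal.ofReal α * ENNReal.ofReal (w γ))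
    (G₀ : Set G) (α₀ : ℝ) (hα₀pos : 0 ≤ α₀)
    (hα₀ : ∑' γ : G₀, ENNReal.ofReal (w γ * Real.exp (-β * w γ)) ≤ ENNReal.ofReal α₀) :
    ∑' γ : G₀, ENNReal.ofReal (Real.exp (-β * w γ)) *
        ∑' n : ℕ, ∑' θ : G, ENNReal.ofReal (w θ) * contourKernelIter w inc β n (γ : G) θ ≤
      ENNReal.ofReal (α₀ / (1 - α)) := by
  have total_weight_le : ∀ γ : G,
      ∑' n : ℕ, ∑' θ : G, ENNReal.ofReal (w θ) * contourKernelIter w inc β n γ θ ≤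
        (1 - ENNReal.ofReal α)⁻¹ * ENNReal.ofReal (w γ) := fun γ => by
    rw [← ENNReal.tsum_geometric, ← ENNReal.tsum_mul_right]
    exact ENNReal.tsum_le_tsum fun n =>
      tsum_weight_mul_contourKernelIter_le w inc β _ hbranch n γ
  calc ∑' γ : G₀, ENNReal.ofReal (Real.exp (-β * w γ)) *
        ∑' n : ℕ, ∑' θ : G, ENNReal.ofReal (w θ) * contourKernelIter w inc β n (γ : G) θ
      ≤ ∑' γ : G₀, (1 - ENNReal.ofReal α)⁻¹ *
          ENNReal.ofReal (w γ * Real.exp (-β * w γ)) := by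
        refine ENNReal.tsum_le_tsum fun γ => (mul_le_mul_right (total_weight_le γ) _).trans_eq ?_
        rw [ENNReal.ofReal_mul (zero_le_one.trans (hw γ))]
        ring
    _ ≤ (1 - ENNReal.ofReal α)⁻¹ * ENNReal.ofReal α₀ := by
        rw [ENNReal.tsum_mul_left]
        gcongr
    _ = ENNReal.ofReal (α₀ / (1 - α)) := by
        rw [ENNReal.ofReal_div_of_pos (sub_pos.2 hα1), ENNReal.ofReal_sub _ hα,
          ENNReal.ofReal_one, ENNReal.div_eq_inv_mul]
end

section
/- Let β̃ ≤ β and suppose constants α̃ and α̃₀ satisfy the branching and α₀ conditions at parameter β̃, namely Σ_{θ: θ≁γ} |θ|·e^{−β̃|θ|} ≤ α̃·|γ| for all γ ∈ G and Σ_{γ∈G₀} |γ|·e^{−β̃|γ|} ≤ α̃₀, with α̃ < 1. Then for every ℓ ≥ 0: Σ_{k≥1} Σ_{(γ₁,…,γ_k) k-chain with |γ₁|+⋯+|γ_k| ≥ ℓ} Π_{i=1}^k e^{−β|γᵢ|} ≤ (α̃₀/(1−α̃))·e^{−(β−β̃)ℓ}. (This is the majorant proving the tail bound P(SW(A^{x,t})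 ≥ ℓ) ≤ (α₀(β̃)/(1−α(β̃))) e^{−(β−β̃)ℓ} of Theorem 5.3(v).) -/
open scoped ENNReal Classical

/-- A `k`-chain of contours: a tuple `(γ₁,…,γ_k)` with `γ₁ ∈ G₀` (the contours
containing the fixed site) and `γ_{i+1} ≁ γ_i` for all `1 ≤ i < k`.  Here
`inc θ γ` means "θ is incompatible with γ". -/
def IsContourChain {G : Type*} (inc : G → G → Prop) (G₀ : Set G) {k : ℕ}
    (c : Fin k → G) : Prop :=
  (∀ h : 0 < k, c ⟨0, h⟩ ∈ G₀) ∧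
    ∀ (i : ℕ) (h : i + 1 < k), inc (c ⟨i + 1, h⟩) (c ⟨i, Nat.lt_of_succ_lt h⟩)

theorem isContourChain_cons {G : Type*} (inc : G → G → Prop) (A : Set G) {k : ℕ} (γ : G)
    (c : Fin k → G) :
    IsContourChain inc A (Fin.cons γ c : Fin (k + 1) → G) ↔
      γ ∈ A ∧ IsContourChain inc {θ | inc θ γ} c := by
  constructor
  · rintro ⟨h₀, h⟩
    refine ⟨h₀ k.succ_pos, fun hk => h 0 (Nat.succ_lt_succ hk), fun i hi => h (i + 1) (by omega)⟩
  · rintro ⟨hγ, h₀, h⟩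
    refine ⟨fun _ => hγ, fun i hi => ?_⟩
    cases i with
    | zero => exact h₀ (by omega)
    | succ i => exact h i (by omega)

theorem tsum_chain_succ {G : Type*} (inc : G → G → Prop) (A : Set G) (a : G → ℝ≥0∞) (k : ℕ) :
    ∑' c : Fin (k + 1) → G, (if IsContourChain inc A c then ∏ i, a (c i) else 0) =
      ∑' γ : G, if γ ∈ A then
        a γ * ∑' c : Fin k → G,
          (if IsContourChain inc {θ | inc θ γ} c then ∏ i, a (c i) else 0)
      else 0 := by
  rw [← (Fin.consEquiv fun _ : Fin (k + 1) => G).tsum_eq, ENNReal.tsum_prod']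
  refine tsum_congr fun γ => ?_
  split_ifs with hγ
  · rw [← ENNReal.tsum_mul_left]
    refine tsum_congr fun c => ?_
    simp [Fin.consEquiv, isContourChain_cons, hγ, Fin.prod_univ_succ]
  · simp [Fin.consEquiv, isContourChain_cons, hγ]

/-- Iterating a branching condition bounds the sum over chains of length `k` that
continue a given contour. -/
theorem tsum_chain_tail_le {G : Type*} (inc : G → G → Prop) (a b : G → ℝ≥0∞) (α : ℝ≥0∞)
    (hb : ∀ γ, 1 ≤ b γ)
    (hbranch : ∀ γ, ∑' θ : G, (if inc θ γ then b θ * a θ else 0) ≤ α * b γ) (k : ℕ) (γ : G) :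
    ∑' c : Fin k → G, (if IsContourChain inc {θ | inc θ γ} c then ∏ i, a (c i) else 0) ≤
      α ^ k * b γ := by
  induction k generalizing γ with
  | zero => simpa [IsContourChain] using hb γ
  | succ k ih =>
    rw [tsum_chain_succ]
    calc _ ≤ ∑' θ : G, α ^ k * (if inc θ γ then b θ * a θ else 0) := by
          refine ENNReal.tsum_le_tsum fun θ => ?_
          simp only [Set.mem_ofPred_eq]
          split_ifs
          · calc _ ≤ a θ * (α ^ k * b θ) := by gcongr; exact ih θ
              _ = _ := by ring
          · simp
      _ ≤ α ^ k * (α * b γ) := by rw [ENNReal.tsum_mul_left]; gcongr; exact hbranch γ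
      _ = _ := by ring

theorem tsum_chain_le {G : Type*} (inc : G → G → Prop) (a b : G → ℝ≥0∞) (α : ℝ≥0∞)
    (hb : ∀ γ, 1 ≤ b γ)
    (hbranch : ∀ γ, ∑' θ : G, (if inc θ γ then b θ * a θ else 0) ≤ α * b γ) (A : Set G)
    (k : ℕ) :
    ∑' c : Fin (k + 1) → G, (if IsContourChain inc A c then ∏ i, a (c i) else 0) ≤
      α ^ k * ∑' γ : A, b γ * a γ := by
  rw [tsum_chain_succ, tsum_subtype A fun γ => b γ * a γ, ← ENNReal.tsum_mul_left]
  refine ENNReal.tsum_le_tsum fun γ => ?_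
  by_cases hγ : γ ∈ A
  · rw [if_pos hγ, Set.indicator_of_mem hγ]
    calc _ ≤ a γ * (α ^ k * b γ) := by
          gcongr; exact tsum_chain_tail_le inc a b α hb hbranch k γ
      _ = _ := by ring
  · simp [hγ]

theorem prod_exp_le_of_le_sum {ι : Type*} (s : Finset ι) (w : ι → ℝ) {β βt ℓ : ℝ} (h : βt ≤ β)
    (hℓ : ℓ ≤ ∑ i ∈ s, w i) :
    ∏ i ∈ s, Real.exp (-β * w i) ≤
      Real.exp (-(β - βt) * ℓ) * ∏ i ∈ s, Real.exp (-βt * w i) := by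
  rw [← Real.exp_sum, ← Real.exp_sum, ← Real.exp_add, ← Finset.mul_sum, ← Finset.mul_sum]
  gcongr
  nlinarith [mul_le_mul_of_nonneg_left hℓ (sub_nonneg.2 h)]

/-- Majorant proving the tail bound
`P(SW(A^{x,t}) ≥ ℓ) ≤ (α₀(β̃)/(1-α(β̃))) e^{-(β-β̃)ℓ}` of Theorem 5.3(v):
if `β̃ ≤ β` and `α̃ < 1`, `α̃₀` satisfy the branching and `α₀` conditions at
parameter `β̃`, then the sum over all chains of total weight at least `ℓ` of
`Πᵢ e^{-β|γᵢ|}` is at most `(α̃₀/(1-α̃)) e^{-(β-β̃)ℓ}`. -/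
theorem chain_tail_sum_le {G : Type*} [Countable G] (w : G → ℝ)
    (hw : ∀ γ : G, 1 ≤ w γ) (inc : G → G → Prop) (β βt : ℝ) (hββt : βt ≤ β)
    (αt : ℝ) (hαtpos : 0 ≤ αt) (hαt1 : αt < 1)
    (hbranch : ∀ γ : G,
      ∑' θ : G, (if inc θ γ then ENNReal.ofReal (w θ * Real.exp (-βt * w θ)) else 0) ≤
        ENNReal.ofReal αt * ENNReal.ofReal (w γ))
    (G₀ : Set G) (αt₀ : ℝ) (hαt₀pos : 0 ≤ αt₀)
    (hαt₀ : ∑' γ : G₀, ENNReal.ofReal (w γ * Real.exp (-βt * w γ)) ≤ ENNReal.ofReal αt₀)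
    (ℓ : ℝ) (hℓ : 0 ≤ ℓ) :
    ∑' k : ℕ, ∑' c : Fin (k + 1) → G,
        (if IsContourChain inc G₀ c ∧ ℓ ≤ ∑ i : Fin (k + 1), w (c i) then
          ENNReal.ofReal (∏ i : Fin (k + 1), Real.exp (-β * w (c i))) else 0) ≤
      ENNReal.ofReal (αt₀ / (1 - αt) * Real.exp (-(β - βt) * ℓ)) := by
  set a : G → ℝ≥0∞ := fun γ => ENNReal.ofReal (Real.exp (-βt * w γ)) with ha
  set b : G → ℝ≥0∞ := fun γ => ENNReal.ofReal (w γ) with hb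
  set E : ℝ≥0∞ := ENNReal.ofReal (Real.exp (-(β - βt) * ℓ)) with hE
  have hba : ∀ γ, ENNReal.ofReal (w γ * Real.exp (-βt * w γ)) = b γ * a γ := fun γ =>
    ENNReal.ofReal_mul (zero_le_one.trans (hw γ))
  simp only [hba] at hbranch hαt₀
  have hb1 : ∀ γ, 1 ≤ b γ := fun γ => ENNReal.one_le_ofReal.2 (hw γ)
  calc _ ≤ ∑' k : ℕ, E * (ENNReal.ofReal αt ^ k * ENNReal.ofReal αt₀) := by
        refine ENNReal.tsum_le_tsum fun k => ?_
        calc _ ≤ ∑' c : Fin (k + 1) → G,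
              E * (if IsContourChain inc G₀ c then ∏ i, a (c i) else 0) := by
              refine ENNReal.tsum_le_tsum fun c => ?_
              split_ifs with h₁ h₂ h₂
              · rw [hE, ha, ← ENNReal.ofReal_prod_of_nonneg fun i _ => (Real.exp_pos _).le,
                  ← ENNReal.ofReal_mul (Real.exp_pos _).le]
                exact ENNReal.ofReal_le_ofReal (prod_exp_le_of_le_sum _ _ hββt h₁.2)
              · exact absurd h₁.1 h₂
              · exact zero_le
              · exact zero_le
          _ ≤ _ := by
              rw [ENNReal.tsum_mul_left]
              gcongr
              exact (tsum_chain_le inc a b _ hb1 hbranch G₀ k).trans (by gcongr)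
    _ = _ := by
        rw [ENNReal.tsum_mul_left, ENNReal.tsum_mul_right, ENNReal.tsum_geometric,
          ENNReal.ofReal_mul (div_nonneg hαt₀pos (sub_pos.2 hαt1).le),
          ENNReal.ofReal_div_of_pos (sub_pos.2 hαt1), ENNReal.ofReal_sub _ hαtpos,
          ENNReal.ofReal_one, div_eq_mul_inv, mul_comm E, mul_comm (ENNReal.ofReal αt₀)]
end
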